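/- Let A = k⟨x^{±1}, y^{±1}⟩ (free product of two Laurent polynomial rings) with double Poisson bracket determined by {{x,y}} = 1⊗1. Then δ = [x,y] satisfies {{δ,a}} = a⊗1 - 1⊗a for all a ∈ A. In particular the quotient A/⟨δ⟩ is isomorphic to the commutative Laurent polynomial ring k[x^{±1}, y^{±1}]. -/

import Mathlib

/-!
STATEMENT 10: Let A = k⟨x^{±1}, y^{±1}⟩ (the group algebra of the free group on two
generators) with the double bracket determined by {{x,y}} = 1⊗1 (all other brackets
of generators zero).  Then δ = [x,y] satisfies {{δ,a}} = a⊗1 - 1⊗a for all a, and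
A/⟨δ⟩ (quotient by the two-sided ideal generated by δ) is isomorphic to the
commutative Laurent polynomial ring k[x^{±1}, y^{±1}] = k[ℤ × ℤ].
-/

open TensorProduct

namespace Stmt10

noncomputable abbrev A' (k : Type*) [Field k] := MonoidAlgebra k (FreeGroup (Fin 2))

noncomputable abbrev xg (k : Type*) [Field k] : A' k :=
  MonoidAlgebra.of k (FreeGroup (Fin 2)) (FreeGroup.of 0)

noncomputable abbrev yg (k : Type*) [Field k] : A' k :=
  MonoidAlgebra.of k (FreeGroup (Fin 2)) (FreeGroup.of 1)

lemma der_zero (k : Type*) [Field k] (F : A' k →ₗ[k] A' k ⊗[k] A' k)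
    (hF : ∀ b c : A' k, F (b * c) = F b * (1 ⊗ₜ[k] c) + (b ⊗ₜ[k] 1) * F c)
    (hx : F (xg k) = 0) (hy : F (yg k) = 0) (a : A' k) : F a = 0 := by
  have h1 : F 1 = 0 := by
    have h := hF 1 1
    rw [← Algebra.TensorProduct.one_def, mul_one, mul_one, one_mul] at h
    simpa using h
  have hg : ∀ g : FreeGroup (Fin 2), F (MonoidAlgebra.of k _ g) = 0 := by
    intro g
    induction g using FreeGroup.induction_on with
    | C1 => rw [map_one]; exact h1
    | of i => fin_cases i
              · exact hx
              · exact hy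
    | inv_of i h =>
      have h2 := hF (MonoidAlgebra.of k _ (FreeGroup.of i)) (MonoidAlgebra.of k _ (FreeGroup.of i)⁻¹)
      rw [← map_mul, mul_inv_cancel, map_one, h1] at h2
      change F (MonoidAlgebra.of k _ (FreeGroup.of i)) = 0 at h
      rw [h, zero_mul, zero_add] at h2
      have h3 := congrArg (fun t => ((MonoidAlgebra.of k _ (FreeGroup.of i)⁻¹) ⊗ₜ[k] (1 : A' k)) * t) h2
      simp only [← mul_assoc, Algebra.TensorProduct.tmul_mul_tmul, ← map_mul, inv_mul_cancel, map_one,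
        mul_zero, mul_one] at h3
      rw [← Algebra.TensorProduct.one_def, one_mul] at h3
      exact h3.symm
    | mul a b ha hb => rw [map_mul, hF, ha, hb, zero_mul, mul_zero, add_zero]
  induction a using MonoidAlgebra.induction_on with
  | of g => exact hg g
  | add a b ha hb => rw [map_add, ha, hb, add_zero]
  | smul r a ha => rw [map_smul, ha, smul_zero]

lemma comm_mul' (k : Type*) [Field k] (u v : A' k ⊗[k] A' k) :
    (TensorProduct.comm k _ _) (u * v) =
      (TensorProduct.comm k (A' k) (A' k)) u * (TensorProduct.comm k (A' k) (A' k)) v :=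
  map_mul (Algebra.TensorProduct.comm k (A' k) (A' k)) u v

lemma tneg_mul (k : Type*) [Field k] (u v : A' k ⊗[k] A' k) : (-u) * v = -(u * v) := by
  exact neg_mul u v

lemma tmul_neg' (k : Type*) [Field k] (u v : A' k ⊗[k] A' k) : u * (-v) = -(u * v) := by
  exact mul_neg u v

lemma moment (k : Type*) [Field k]
    (D : A' k →ₗ[k] A' k →ₗ[k] A' k ⊗[k] A' k)
    (hder : ∀ a b c : A' k, D a (b * c) = D a b * (1 ⊗ₜ[k] c) + (b ⊗ₜ[k] 1) * D a c)
    (hanti : ∀ a b : A' k, D a b = - (TensorProduct.comm k _ _) (D b a))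
    (hxy : D (xg k) (yg k) = 1 ⊗ₜ[k] 1)
    (hxx : D (xg k) (xg k) = 0)
    (hyy : D (yg k) (yg k) = 0) (a : A' k) :
    D (xg k * yg k - yg k * xg k) a = a ⊗ₜ[k] 1 - 1 ⊗ₜ[k] a := by
  have hyx : D (yg k) (xg k) = - (1 ⊗ₜ[k] 1) := by
    rw [hanti, hxy, TensorProduct.comm_tmul]
  have hl : ∀ a b c : A' k, D (a * b) c = D a c * (b ⊗ₜ[k] 1) + (1 ⊗ₜ[k] a) * D b c := by
    intro a b c
    rw [hanti (a * b) c, hder, map_add, comm_mul', comm_mul', hanti a c, hanti b c]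
    simp only [TensorProduct.comm_tmul, tneg_mul, tmul_neg', neg_add]
  let F : A' k →ₗ[k] A' k ⊗[k] A' k := D (xg k * yg k - yg k * xg k) -
    ((TensorProduct.mk k (A' k) (A' k)).flip 1 - TensorProduct.mk k (A' k) (A' k) 1)
  have hFa : ∀ a, F a = D (xg k * yg k - yg k * xg k) a - (a ⊗ₜ[k] 1 - 1 ⊗ₜ[k] a) := fun a => rfl
  have h := der_zero k F ?_ ?_ ?_ a
  · rw [hFa] at h
    exact sub_eq_zero.mp h
  · intro b c
    simp only [hFa, hder]
    simp only [sub_mul, mul_sub, Algebra.TensorProduct.tmul_mul_tmul, one_mul, mul_one]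
    abel
  · rw [hFa, map_sub, LinearMap.sub_apply, hl, hl, hxx, hyx]
    simp only [tneg_mul, tmul_neg', Algebra.TensorProduct.tmul_mul_tmul, one_mul, mul_one, zero_mul, mul_zero]
    abel
  · rw [hFa, map_sub, LinearMap.sub_apply, hl, hl, hyy, hxy]
    simp only [Algebra.TensorProduct.tmul_mul_tmul, one_mul, mul_one, zero_mul, mul_zero]
    abel

lemma quot (k : Type*) [Field k] : ∃ f : A' k →ₐ[k] AddMonoidAlgebra k (ℤ × ℤ),
      f (xg k) = AddMonoidAlgebra.single ((1 : ℤ), (0 : ℤ)) (1 : k) ∧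
      f (yg k) = AddMonoidAlgebra.single ((0 : ℤ), (1 : ℤ)) (1 : k) ∧
      Function.Surjective f ∧
      RingHom.ker f
        = Ideal.span {z : A' k | ∃ b : A' k,
            z = (xg k * yg k - yg k * xg k) * b} := by
  let p : FreeGroup (Fin 2) →* Multiplicative (ℤ × ℤ) :=
    FreeGroup.lift ![Multiplicative.ofAdd (1, 0), Multiplicative.ofAdd (0, 1)]
  have hp0 : p (FreeGroup.of 0) = Multiplicative.ofAdd (1, 0) := by simp [p]
  have hp1 : p (FreeGroup.of 1) = Multiplicative.ofAdd (0, 1) := by simp [p]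
  let f : A' k →ₐ[k] AddMonoidAlgebra k (ℤ × ℤ) :=
    MonoidAlgebra.lift k _ _ ((AddMonoidAlgebra.of k (ℤ × ℤ)).comp p)
  have hf : ∀ g, f (MonoidAlgebra.of k _ g) = AddMonoidAlgebra.of k (ℤ × ℤ) (p g) := by
    intro g
    simp [f]
  have hfx : f (xg k) = AddMonoidAlgebra.single ((1 : ℤ), (0 : ℤ)) (1 : k) := by
    rw [hf, hp0]; rfl
  have hfy : f (yg k) = AddMonoidAlgebra.single ((0 : ℤ), (1 : ℤ)) (1 : k) := by
    rw [hf, hp1]; rfl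
  refine ⟨f, hfx, hfy, ?_, ?_⟩
  · intro z
    induction z using AddMonoidAlgebra.induction_on with
    | of g =>
      refine ⟨MonoidAlgebra.of k _ (FreeGroup.of 0 ^ g.1 * FreeGroup.of 1 ^ g.2), ?_⟩
      rw [hf, map_mul, map_zpow, map_zpow, hp0, hp1]
      congr 1
      apply Multiplicative.toAdd.injective
      ext <;> simp
    | add a b ha hb =>
      obtain ⟨a, rfl⟩ := ha
      obtain ⟨b, rfl⟩ := hb
      exact ⟨a + b, map_add _ _ _⟩
    | smul r a ha =>
      obtain ⟨a, rfl⟩ := ha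
      exact ⟨r • a, map_smul _ _ _⟩
  · set I : Ideal (A' k) := Ideal.span {z : A' k | ∃ b : A' k,
            z = (xg k * yg k - yg k * xg k) * b} with hI
    apply le_antisymm
    · have hts : I.IsTwoSided := by
        constructor
        intro a b ha
        induction ha using Submodule.span_induction with
        | mem z hz =>
          obtain ⟨c, rfl⟩ := hz
          exact Ideal.subset_span ⟨c * b, by rw [mul_assoc]⟩
        | zero => rw [zero_mul]; exact I.zero_mem
        | add u v _ _ hu hv => rw [add_mul]; exact I.add_mem hu hv
        | smul r u _ hu => rw [smul_eq_mul, mul_assoc]; exact I.mul_mem_left _ hu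
      let m : A' k →ₐ[k] A' k ⧸ I := Ideal.Quotient.mkₐ k I
      let φ : FreeGroup (Fin 2) →* (A' k ⧸ I)ˣ :=
        (Units.map ((m : A' k →* A' k ⧸ I).comp (MonoidAlgebra.of k _))).comp toUnits.toMonoidHom
      have hφ : ∀ g, (φ g : A' k ⧸ I) = m (MonoidAlgebra.of k _ g) := fun g => rfl
      have hc : Commute (φ (FreeGroup.of 0)) (φ (FreeGroup.of 1)) := by
        apply Units.ext
        rw [Units.val_mul, Units.val_mul, hφ, hφ, ← map_mul, ← map_mul]
        refine Ideal.Quotient.eq.mpr (Ideal.subset_span ⟨1, ?_⟩)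
        rw [mul_one, map_mul]
      let ψ : Multiplicative (ℤ × ℤ) →* (A' k ⧸ I)ˣ :=
        { toFun := fun n => φ (FreeGroup.of 0) ^ n.toAdd.1 * φ (FreeGroup.of 1) ^ n.toAdd.2
          map_one' := by simp
          map_mul' := by
            intro a b
            simp only [toAdd_mul, Prod.fst_add, Prod.snd_add, zpow_add]
            rw [mul_assoc, mul_assoc, ← mul_assoc (φ (FreeGroup.of 0) ^ _) (φ (FreeGroup.of 1) ^ _),
              ← mul_assoc _ (φ (FreeGroup.of 0) ^ _) (φ (FreeGroup.of 1) ^ _),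
              (hc.zpow_zpow _ _).eq, mul_assoc] }
      have hψ : ψ.comp p = φ := by
        apply FreeGroup.ext_hom
        intro i
        fin_cases i
        · change ψ (p (FreeGroup.of 0)) = φ (FreeGroup.of 0)
          rw [hp0]; simp [ψ]
        · change ψ (p (FreeGroup.of 1)) = φ (FreeGroup.of 1)
          rw [hp1]; simp [ψ]
      let g : AddMonoidAlgebra k (ℤ × ℤ) →ₐ[k] A' k ⧸ I :=
        AddMonoidAlgebra.lift k _ _ ((Units.coeHom _).comp ψ)
      have hgf : ∀ z, g (f z) = m z := by
        intro z
        induction z using MonoidAlgebra.induction_on with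
        | of w =>
          rw [hf, ← hφ, ← hψ]
          simp [g]
        | add a b ha hb => rw [map_add, map_add, map_add, ha, hb]
        | smul r a ha => rw [map_smul, map_smul, map_smul, ha]
      intro z hz
      have hz' : f z = 0 := hz
      have := hgf z
      rw [hz', map_zero] at this
      exact Ideal.Quotient.eq_zero_iff_mem.mp this.symm
    · rw [hI, Ideal.span_le]
      rintro z ⟨b, rfl⟩
      change f _ = 0
      rw [map_mul, map_sub, map_mul, map_mul, hfx, hfy, mul_comm, sub_eq_zero.mpr, mul_zero]
      exact mul_comm _ _

theorem laurent_moment_and_quotient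
    (k : Type*) [Field k]
    (D : A' k →ₗ[k] A' k →ₗ[k] A' k ⊗[k] A' k)
    -- derivation in the second argument for the outer bimodule structure
    (hder : ∀ a b c : A' k, D a (b * c) = D a b * (1 ⊗ₜ[k] c) + (b ⊗ₜ[k] 1) * D a c)
    -- antisymmetry {{a,b}} = -{{b,a}}°
    (hanti : ∀ a b : A' k, D a b = - (TensorProduct.comm k _ _) (D b a))
    -- values on generators: {{x,y}} = 1⊗1, all other brackets of generators zero
    (hxy : D (xg k) (yg k) = 1 ⊗ₜ[k] 1)
    (hxx : D (xg k) (xg k) = 0)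
    (hyy : D (yg k) (yg k) = 0) :
    -- δ = [x,y] is a noncommutative moment map ...
    (∀ a : A' k, D (xg k * yg k - yg k * xg k) a = a ⊗ₜ[k] 1 - 1 ⊗ₜ[k] a) ∧
    -- ... and A/⟨δ⟩ ≅ k[x^{±1}, y^{±1}]
    (∃ f : A' k →ₐ[k] AddMonoidAlgebra k (ℤ × ℤ),
      f (xg k) = AddMonoidAlgebra.single ((1 : ℤ), (0 : ℤ)) (1 : k) ∧
      f (yg k) = AddMonoidAlgebra.single ((0 : ℤ), (1 : ℤ)) (1 : k) ∧
      Function.Surjective f ∧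
      RingHom.ker f
        = Ideal.span {z : A' k | ∃ b : A' k,
            z = (xg k * yg k - yg k * xg k) * b}) :=
  ⟨moment k D hder hanti hxy hxx hyy, quot k⟩

end Stmt10
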